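/- arXiv:1102.4156 — 2 statements merged into one kernel-verified Lean document; each statement's English description precedes it below -/
import Mathlib

section
/- (Lemma L-1, Sturm-type rigidity under a divergent integral condition.) Let K, G : [0,∞) → ℝ be continuous functions with K(t) ≥ G(t) for all t ∈ [0,∞). Let f, m : [0,∞) → ℝ be twice continuously differentiable functions satisfying the ordinary differential equations f''(t) + K(t) f(t) = 0 with f(0) = 1 and f'(0) = 0, and m''(t) + G(t) m(t) = 0 with m(0) = 1 and m'(0) = 0. If f(t) > 0 for all t ∈ (0,∞), m(t) > 0 for all t ∈ (0,∞), and the improper integral ∫₀^∞ 1/m(t)² dt diverges to infinity, then K(t) = G(t) for all t ∈ [0,∞). -/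
open Filter

/-- Two functions `f` and `m` with Wronskian `W = f' m - f m'` satisfy `W' = f'' m - f m''` everywhere. -/
theorem hasDerivAt_wronskian {f m : ℝ → ℝ} (hf : ContDiff ℝ 2 f) (hm : ContDiff ℝ 2 m) (t : ℝ) :
    HasDerivAt (fun s => deriv f s * m s - f s * deriv m s)
      (deriv (deriv f) t * m t - f t * deriv (deriv m) t) t := by
  have first {g : ℝ → ℝ} (hg : ContDiff ℝ 2 g) : HasDerivAt g (deriv g t) t :=
    (hg.differentiable two_ne_zero t).hasDerivAt
  have second {g : ℝ → ℝ} (hg : ContDiff ℝ 2 g) : HasDerivAt (deriv g) (deriv (deriv g) t) t :=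
    (hg.differentiable_deriv_two t).hasDerivAt
  exact (((second hf).mul (first hm)).sub ((first hf).mul (second hm))).congr_deriv (by ring)

/-- If `m > 0` on `[0, ∞)` and `∫ 1 / m²` diverges, a function `h` with `h' ≤ -c / m²` eventually,
for some `c > 0`, cannot stay positive. -/
theorem exists_nonpos_of_deriv_le_of_tendsto_integral {h h' m : ℝ → ℝ} {a c : ℝ} (ha : 0 < a)
    (hc : 0 < c) (hm : Continuous m) (hmpos : ∀ t, 0 ≤ t → 0 < m t)
    (hh : ∀ t, a ≤ t → HasDerivAt h (h' t) t) (hle : ∀ t, a ≤ t → h' t ≤ -c / m t ^ 2)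
    (hint : Tendsto (fun T => ∫ t in (0 : ℝ)..T, 1 / m t ^ 2) atTop atTop) :
    ∃ t, a ≤ t ∧ h t ≤ 0 := by
  set I : ℝ → ℝ := fun T => ∫ t in (0 : ℝ)..T, 1 / m t ^ 2
  have hmeas : Measurable fun t => 1 / m t ^ 2 :=
    measurable_const.div (hm.measurable.pow_const 2)
  have hIderiv (t : ℝ) (ht : a ≤ t) : HasDerivAt I (1 / m t ^ 2) t := by
    have ht0 : 0 ≤ t := ha.le.trans ht
    refine intervalIntegral.integral_hasDerivAt_right ?_
      hmeas.stronglyMeasurable.stronglyMeasurableAtFilter ?_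
    · refine ContinuousOn.intervalIntegrable fun s hs => ?_
      rw [Set.uIcc_of_le ht0] at hs
      exact (continuousAt_const.div (hm.continuousAt.pow 2)
        (pow_pos (hmpos s hs.1) 2).ne').continuousWithinAt
    · exact continuousAt_const.div (hm.continuousAt.pow 2) (pow_pos (hmpos t ht0) 2).ne'
  have hderiv (t : ℝ) (ht : a ≤ t) :
      HasDerivAt (fun s => h s + c * I s) (h' t + c * (1 / m t ^ 2)) t :=
    (hh t ht).add ((hIderiv t ht).const_mul c)
  have hanti : AntitoneOn (fun s => h s + c * I s) (Set.Ici a) := by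
    refine antitoneOn_of_hasDerivWithinAt_nonpos (convex_Ici a)
      (fun t ht => (hderiv t ht).continuousAt.continuousWithinAt)
      (fun t ht => (hderiv t (interior_subset ht)).hasDerivWithinAt) fun t ht => ?_
    have := hle t (interior_subset ht)
    rw [neg_div] at this
    rw [mul_one_div]
    linarith
  obtain ⟨T, hT, haT⟩ := ((hint.eventually_ge_atTop ((h a + c * I a) / c)).and
    (eventually_ge_atTop a)).exists
  refine ⟨T, haT, ?_⟩
  have h1 := hanti Set.self_mem_Ici haT haT
  have h2 : h a + c * I a ≤ I T * c := (div_le_iff₀ hc).1 hT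
  simp only at h1
  linarith

/-- (L–1) of Lemma 6.1: Sturm-type rigidity under a divergent integral condition. -/
theorem sturm_rigidity_of_divergent_integral
    (K G f m : ℝ → ℝ)
    (hKcont : ContinuousOn K (Set.Ici 0)) (hGcont : ContinuousOn G (Set.Ici 0))
    (hKG : ∀ t, 0 ≤ t → G t ≤ K t)
    (hf : ContDiff ℝ 2 f) (hm : ContDiff ℝ 2 m)
    (hfode : ∀ t, 0 ≤ t → deriv (deriv f) t + K t * f t = 0)
    (hf0 : f 0 = 1) (hf'0 : deriv f 0 = 0)
    (hmode : ∀ t, 0 ≤ t → deriv (deriv m) t + G t * m t = 0)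
    (hm0 : m 0 = 1) (hm'0 : deriv m 0 = 0)
    (hfpos : ∀ t, 0 < t → 0 < f t)
    (hmpos : ∀ t, 0 < t → 0 < m t)
    (hint : Tendsto (fun T => ∫ t in (0:ℝ)..T, 1 / (m t) ^ 2) atTop atTop) :
    ∀ t, 0 ≤ t → K t = G t := by
  have pos_of_nonneg {g : ℝ → ℝ} (hg0 : g 0 = 1) (hgpos : ∀ t, 0 < t → 0 < g t) (t : ℝ)
      (ht : 0 ≤ t) : 0 < g t := by
    rcases ht.eq_or_lt with rfl | ht
    · simp [hg0]
    · exact hgpos t ht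
  have hfpos' := pos_of_nonneg hf0 hfpos
  have hmpos' := pos_of_nonneg hm0 hmpos
  set W : ℝ → ℝ := fun s => deriv f s * m s - f s * deriv m s with hW
  have hW0 : W 0 = 0 := by simp [hW, hf'0, hm'0]
  have hWderiv (t : ℝ) (ht : 0 ≤ t) : HasDerivAt W ((G t - K t) * (f t * m t)) t :=
    (hasDerivAt_wronskian hf hm t).congr_deriv <| by
      linear_combination m t * hfode t ht - f t * hmode t ht
  have hWanti : AntitoneOn W (Set.Ici 0) := by
    refine antitoneOn_of_hasDerivWithinAt_nonpos (convex_Ici 0)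
      (fun t ht => (hWderiv t ht).continuousAt.continuousWithinAt)
      (fun t ht => (hWderiv t (interior_subset ht)).hasDerivWithinAt) fun t ht => ?_
    have ht0 : 0 ≤ t := interior_subset ht
    exact mul_nonpos_of_nonpos_of_nonneg (sub_nonpos.2 (hKG t ht0))
      (mul_pos (hfpos' t ht0) (hmpos' t ht0)).le
  have hWzero (a : ℝ) (ha : 0 ≤ a) : W a = 0 := by
    refine le_antisymm (hW0 ▸ hWanti Set.self_mem_Ici ha ha) (not_lt.1 fun hneg => ?_)
    have ha' : 0 < a := ha.lt_of_ne (by rintro rfl; exact hneg.ne hW0)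
    obtain ⟨t, hat, ht⟩ := exists_nonpos_of_deriv_le_of_tendsto_integral
      (h := fun s => f s / m s) (h' := fun s => W s / m s ^ 2) ha' (neg_pos.2 hneg) hm.continuous
      hmpos'
      (fun t ht => (hf.differentiable two_ne_zero t).hasDerivAt.div
        (hm.differentiable two_ne_zero t).hasDerivAt (hmpos' t (ha.trans ht)).ne')
      (fun t ht => by
        rw [neg_neg]
        exact div_le_div_of_nonneg_right (hWanti ha (ha.trans ht) ht) (sq_nonneg _))
      hint
    exact ht.not_gt (div_pos (hfpos' t (ha.trans hat)) (hmpos' t (ha.trans hat)))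
  intro t ht
  have hzero : HasDerivWithinAt W 0 (Set.Ici t) t :=
    (hasDerivWithinAt_const t (Set.Ici t) (0 : ℝ)).congr
      (fun s hs => hWzero s (ht.trans hs)) (hWzero t ht)
  have heq := (uniqueDiffWithinAt_Ici t).eq_deriv _ (hWderiv t ht).hasDerivWithinAt hzero
  have hne : f t * m t ≠ 0 := (mul_pos (hfpos' t ht) (hmpos' t ht)).ne'
  linarith [(mul_eq_zero.1 heq).resolve_right hne]
end

section
/- (Lemma L-2, forced vanishing under a divergent integral condition.) Let K, G : [0,∞) → ℝ be continuous functions with K(t) ≥ G(t) for all t ∈ [0,∞). Let f, m : [0,∞) → ℝ be twice continuously differentiable functions satisfying f''(t) + K(t) f(t) = 0 with f(0) = 1 and f'(0) < 0, and m''(t) + G(t) m(t) = 0 with m(0) = 1 and m'(0) = 0. If m(t) > 0 for all t ∈ (0,∞) and the improper integral ∫₀^∞ 1/m(t)² dt diverges to infinity, then there exists t₀ ∈ (0,∞) such that f(t) > 0 for all t ∈ [0, t₀) and f(t₀) = 0. -/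
open Filter

/-- A continuous function that is positive at `0` and nonpositive somewhere on `[0, ∞)` has a first
zero there. -/
lemma Continuous.exists_first_zero {f : ℝ → ℝ} (hf : Continuous f) (hf0 : 0 < f 0)
    {T : ℝ} (hT : 0 ≤ T) (hfT : f T ≤ 0) :
    ∃ t₀ : ℝ, 0 < t₀ ∧ (∀ t, 0 ≤ t → t < t₀ → 0 < f t) ∧ f t₀ = 0 := by
  obtain ⟨t₀, ⟨⟨h0, hT₀⟩, hft₀⟩, hleast⟩ :=
    (isCompact_Icc.inter_right (isClosed_Iic.preimage hf) :
      IsCompact (Set.Icc 0 T ∩ f ⁻¹' Set.Iic 0)).exists_isLeast ⟨T, ⟨hT, le_rfl⟩, hfT⟩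
  have hft₀ : f t₀ ≤ 0 := hft₀
  obtain ⟨x, ⟨hx0, hx⟩, hfx⟩ :=
    intermediate_value_Icc' h0 hf.continuousOn ⟨hft₀, hf0.le⟩
  have hxt : x = t₀ := le_antisymm hx (hleast ⟨⟨hx0, hx.trans hT₀⟩, hfx.le⟩)
  refine ⟨t₀, lt_of_le_of_ne h0 ?_, fun t ht htt => ?_, hxt ▸ hfx⟩
  · rintro rfl
    linarith
  · by_contra! h
    exact absurd (hleast ⟨⟨ht, htt.le.trans hT₀⟩, h⟩) (not_le.mpr htt)

/-- **Sturm comparison for the Wronskian**: if `f'' = -K f` and `m'' = -G m` with `G ≤ K`, then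
`f' m - f m'` is nonincreasing as long as `f` and `m` are nonnegative. -/
lemma antitoneOn_wronskian {K G f m : ℝ → ℝ} (hKG : ∀ t, 0 ≤ t → G t ≤ K t)
    (hf : ContDiff ℝ 2 f) (hm : ContDiff ℝ 2 m)
    (hfode : ∀ t, 0 ≤ t → deriv (deriv f) t + K t * f t = 0)
    (hmode : ∀ t, 0 ≤ t → deriv (deriv m) t + G t * m t = 0)
    (hfpos : ∀ t, 0 ≤ t → 0 ≤ f t) (hmpos : ∀ t, 0 ≤ t → 0 ≤ m t) :
    AntitoneOn (fun t => deriv f t * m t - f t * deriv m t) (Set.Ici 0) := by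
  have hW : ∀ t, HasDerivAt (fun t => deriv f t * m t - f t * deriv m t)
      (deriv (deriv f) t * m t + deriv f t * deriv m t
        - (deriv f t * deriv m t + f t * deriv (deriv m) t)) t := fun t =>
    ((hf.differentiable_deriv_two t).hasDerivAt.mul
      (hm.differentiable two_ne_zero t).hasDerivAt).sub
    ((hf.differentiable two_ne_zero t).hasDerivAt.mul
      (hm.differentiable_deriv_two t).hasDerivAt)
  refine antitoneOn_of_hasDerivWithinAt_nonpos (convex_Ici 0)
    (fun t _ => (hW t).continuousAt.continuousWithinAt)
    (fun t _ => (hW t).hasDerivWithinAt) fun t ht => ?_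
  have ht : 0 ≤ t := interior_subset ht
  have hfm := mul_nonneg (sub_nonneg.mpr (hKG t ht)) (mul_nonneg (hfpos t ht) (hmpos t ht))
  linear_combination hfm + m t * hfode t ht - f t * hmode t ht

/-- (L–2) of Lemma 6.1: forced vanishing under a divergent integral condition. -/
theorem forced_vanishing_of_divergent_integral
    (K G f m : ℝ → ℝ)
    (hKcont : ContinuousOn K (Set.Ici 0)) (hGcont : ContinuousOn G (Set.Ici 0))
    (hKG : ∀ t, 0 ≤ t → G t ≤ K t)
    (hf : ContDiff ℝ 2 f) (hm : ContDiff ℝ 2 m)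
    (hfode : ∀ t, 0 ≤ t → deriv (deriv f) t + K t * f t = 0)
    (hf0 : f 0 = 1) (hf'0 : deriv f 0 < 0)
    (hmode : ∀ t, 0 ≤ t → deriv (deriv m) t + G t * m t = 0)
    (hm0 : m 0 = 1) (hm'0 : deriv m 0 = 0)
    (hmpos : ∀ t, 0 < t → 0 < m t)
    (hint : Tendsto (fun T => ∫ t in (0:ℝ)..T, 1 / (m t) ^ 2) atTop atTop) :
    ∃ t₀ : ℝ, 0 < t₀ ∧ (∀ t, 0 ≤ t → t < t₀ → 0 < f t) ∧ f t₀ = 0 := by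
  refine (em (∃ T, 0 ≤ T ∧ f T ≤ 0)).elim
    (fun ⟨T, hT, hfT⟩ => hf.continuous.exists_first_zero (by simp [hf0]) hT hfT) fun hpos => ?_
  push Not at hpos
  exfalso
  have hmpos' : ∀ t, 0 ≤ t → 0 < m t := fun t ht =>
    ht.eq_or_lt.elim (fun h => by simp [← h, hm0]) (hmpos t)
  have hanti := antitoneOn_wronskian hKG hf hm hfode hmode (fun t ht => (hpos t ht).le)
    (fun t ht => (hmpos' t ht).le)
  have hquot : ∀ t, 0 ≤ t → HasDerivAt (fun t => f t / m t)
      ((deriv f t * m t - f t * deriv m t) / m t ^ 2) t := fun t ht =>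
    (hf.differentiable two_ne_zero t).hasDerivAt.div
      (hm.differentiable two_ne_zero t).hasDerivAt (hmpos' t ht).ne'
  have hbound : ∀ T, 0 ≤ T →
      f T / m T - 1 ≤ deriv f 0 * ∫ t in (0:ℝ)..T, 1 / (m t) ^ 2 := by
    intro T hT
    have hcont : ContinuousOn (fun t => deriv f 0 * (1 / (m t) ^ 2)) (Set.Icc 0 T) :=
      continuousOn_const.mul <| continuousOn_const.div (hm.continuous.pow 2).continuousOn
        fun t ht => pow_ne_zero 2 (hmpos' t ht.1).ne'
    have h := intervalIntegral.sub_le_integral_of_hasDeriv_right_of_le hT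
      (fun t ht => (hquot t ht.1).continuousAt.continuousWithinAt)
      (fun t ht => (hquot t ht.1.le).hasDerivWithinAt) hcont.integrableOn_Icc
      fun t ht => by
        have hWt := hanti Set.self_mem_Ici (Set.mem_Ici.mpr ht.1.le) ht.1.le
        simp only [hf0, hm0, hm'0, mul_one, mul_zero, sub_zero] at hWt
        rw [mul_one_div]
        gcongr
    rwa [hf0, hm0, div_one, intervalIntegral.integral_const_mul] at h
  obtain ⟨T, hT, hT0⟩ := ((hint.const_mul_atTop_of_neg hf'0).eventually_lt_atBot (-1)
    |>.and (eventually_ge_atTop 0)).exists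
  have := hbound T hT0
  have := div_pos (hpos T hT0) (hmpos' T hT0)
  linarith
end
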